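/- arXiv:1702.01640 — 4 statements merged into one kernel-verified Lean document; each statement's English description precedes it below -/
import Mathlib

section
/- Let $q \geq 5$ be an integer and let $a, b : \mathbb{N} \to \mathbb{Z}$ be sequences satisfying, for all $n \geq 0$, $a_{n+2} = -2(q-4)a_n - 2(q-3)b_n - 2$ and $b_{n+2} = (q-4)a_n + (q-3)b_n$. Then for all $n \geq 0$, $a_{n+6} = (6-q)a_{n+4} + (q-5)a_{n+2}$ and $b_{n+6} = (6-q)b_{n+4} + (q-5)b_{n+2}$. -/
theorem stmt_1 (q : ℤ) (hq : 5 ≤ q) (a b : ℕ → ℤ)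
    (ha : ∀ n : ℕ, a (n + 2) = -2 * (q - 4) * a n - 2 * (q - 3) * b n - 2)
    (hb : ∀ n : ℕ, b (n + 2) = (q - 4) * a n + (q - 3) * b n) :
    ∀ n : ℕ,
      a (n + 6) = (6 - q) * a (n + 4) + (q - 5) * a (n + 2) ∧
      b (n + 6) = (6 - q) * b (n + 4) + (q - 5) * b (n + 2) := by
  intro n
  rw [ha (n + 4), hb (n + 4), ha (n + 2), hb (n + 2), ha n, hb n]
  constructor <;> ring
end

section
/- Let $q \geq 5$ be an integer and let $a, b : \mathbb{N} \to \mathbb{Z}$ be sequences satisfying, for all $n \geq 0$, $a_{n+3} = -4(q-4)a_n - 4(q-3)b_n - 6$ and $b_{n+3} = 2(q-4)a_n + 2(q-3)b_n + 2$. Then for all $n \geq 0$, $a_{n+9} = (11-2q)a_{n+6} + (2q-10)a_{n+3}$ and $b_{n+9} = (11-2q)b_{n+6} + (2q-10)b_{n+3}$. -/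
theorem stmt_2 (q : ℤ) (hq : 5 ≤ q) (a b : ℕ → ℤ)
    (ha : ∀ n : ℕ, a (n + 3) = -4 * (q - 4) * a n - 4 * (q - 3) * b n - 6)
    (hb : ∀ n : ℕ, b (n + 3) = 2 * (q - 4) * a n + 2 * (q - 3) * b n + 2) :
    ∀ n : ℕ,
      a (n + 9) = (11 - 2 * q) * a (n + 6) + (2 * q - 10) * a (n + 3) ∧
      b (n + 9) = (11 - 2 * q) * b (n + 6) + (2 * q - 10) * b (n + 3) := by
  intro n
  have ha₆ := ha (n + 3)
  have ha₉ := ha (n + 6)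
  have hb₆ := hb (n + 3)
  have hb₉ := hb (n + 6)
  rw [ha₉, hb₉, ha₆, hb₆, ha n, hb n]
  constructor <;> ring
end

section
/- Let $q \geq 6$ be an even integer and let $u : \mathbb{N} \to \mathbb{Z}$ be a sequence with $u_0 = 1$, $u_1 = 0$, $u_2 = 2(q-4)$, satisfying $u_{t+3} = (6-q)u_{t+2} + (q-5)u_{t+1}$ for all $t \geq 0$. Then for all $t \geq 1$, $u_t = -2(5-q)^{t-1} + 2$. -/
theorem stmt_3 (q : ℤ) (hq : 6 ≤ q) (hq2 : Even q) (u : ℕ → ℤ)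
    (h0 : u 0 = 1) (h1 : u 1 = 0) (h2 : u 2 = 2 * (q - 4))
    (hrec : ∀ t : ℕ, u (t + 3) = (6 - q) * u (t + 2) + (q - 5) * u (t + 1)) :
    ∀ t : ℕ, 1 ≤ t → u t = -2 * (5 - q) ^ (t - 1) + 2 := by
  suffices h : ∀ t : ℕ, u (t + 1) = -2 * (5 - q) ^ t + 2 by
    intro t ht
    obtain ⟨s, rfl⟩ := Nat.exists_eq_add_of_le' ht
    exact h s
  intro t
  induction t using Nat.twoStepInduction with
  | zero => simp [h1]
  | one => rw [h2]; ring
  | more t ih ih' => rw [hrec, ih, ih']; ring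
end

section
/- Let $q \geq 7$ be an odd integer and let $b : \mathbb{N} \to \mathbb{Z}$ be a sequence with $b_1 = -2$, $b_2 = 8q - 38$, satisfying $b_{t+2} = (11-2q)b_{t+1} + (2q-10)b_t$ for all $t \geq 1$. Then for all $t \geq 1$, $b_t = 2(-2)^t (q-5)^{t-1} + 2$. -/
theorem stmt_6 (q : ℤ) (hq : 7 ≤ q) (hq2 : Odd q) (b : ℕ → ℤ)
    (h1 : b 1 = -2) (h2 : b 2 = 8 * q - 38)
    (hrec : ∀ t : ℕ, 1 ≤ t → b (t + 2) = (11 - 2 * q) * b (t + 1) + (2 * q - 10) * b t) :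
    ∀ t : ℕ, 1 ≤ t → b t = 2 * (-2) ^ t * (q - 5) ^ (t - 1) + 2 := by
  have closed_form : ∀ n : ℕ, b (n + 1) = 2 * (-2) ^ (n + 1) * (q - 5) ^ n + 2 := by
    intro n
    induction n using Nat.twoStepInduction with
    | zero => simp [h1]
    | one => rw [h2]; ring
    | more n ih ih' =>
      rw [hrec (n + 1) (Nat.le_add_left 1 n), ih, ih']
      ring
  intro t ht
  obtain ⟨n, rfl⟩ := Nat.exists_eq_add_of_le' ht
  exact closed_form n
end
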